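/- Let (L, C) be a hereditary cotorsion pair in Ch(R). Then the following are equivalent: (1) (L, C) is perfect; (2) every complex of R-modules has a C-envelope and every object of C has an L-cover; (3) every complex of R-modules has an L-cover and every object of L has a C-envelope. -/

import Mathlib

open CategoryTheory CategoryTheory.Limits

universe u

section GenericDefs

variable {𝒜 : Type*} [Category 𝒜] [Abelian 𝒜]

/-- An object `G` of an abelian category is *Gorenstein injective* if it is a cycle object of
an exact (ℤ-indexed) complex of injective objects which stays exact under `Hom(I, -)` for
every injective object `I`. -/
def IsGorensteinInjective (G : 𝒜) : Prop :=
  ∃ C : ChainComplex 𝒜 ℤ,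
    (∀ n, Injective (C.X n)) ∧
    (∀ n, C.ExactAt n) ∧
    (∀ (I : 𝒜), Injective I → ∀ n,
      (((preadditiveCoyoneda.obj (Opposite.op I)).mapHomologicalComplex _).obj C).ExactAt n) ∧
    Nonempty (G ≅ kernel (C.d 0 (-1)))

/-- An object `G` is *Gorenstein projective* if it is a cycle object of an exact complex of
projectives which stays exact under `Hom(-, P)` for every projective `P`. -/
def IsGorensteinProjective (G : 𝒜) : Prop :=
  ∃ C : ChainComplex 𝒜 ℤ,
    (∀ n, Projective (C.X n)) ∧
    (∀ n, C.ExactAt n) ∧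
    (∀ (P : 𝒜), Projective P → ∀ n,
      (((preadditiveYoneda.obj P).mapHomologicalComplex _).obj C.op).ExactAt n) ∧
    Nonempty (G ≅ kernel (C.d 0 (-1)))

/-- `φ : G ⟶ X` is a `𝒞`-precover of `X`. -/
def IsPrecover (𝒞 : 𝒜 → Prop) {G X : 𝒜} (φ : G ⟶ X) : Prop :=
  𝒞 G ∧ ∀ (G' : 𝒜), 𝒞 G' → ∀ ψ : G' ⟶ X, ∃ h : G' ⟶ G, h ≫ φ = ψ

/-- `φ : G ⟶ X` is a `𝒞`-cover of `X`. -/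
def IsCover (𝒞 : 𝒜 → Prop) {G X : 𝒜} (φ : G ⟶ X) : Prop :=
  IsPrecover 𝒞 φ ∧ ∀ f : G ⟶ G, f ≫ φ = φ → IsIso f

/-- `φ : X ⟶ G` is a `𝒞`-preenvelope of `X`. -/
def IsPreenvelope (𝒞 : 𝒜 → Prop) {X G : 𝒜} (φ : X ⟶ G) : Prop :=
  𝒞 G ∧ ∀ (G' : 𝒜), 𝒞 G' → ∀ ψ : X ⟶ G', ∃ h : G ⟶ G', φ ≫ h = ψ

/-- `φ : X ⟶ G` is a `𝒞`-envelope of `X`. -/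
def IsEnvelope (𝒞 : 𝒜 → Prop) {X G : 𝒜} (φ : X ⟶ G) : Prop :=
  IsPreenvelope 𝒞 φ ∧ ∀ f : G ⟶ G, φ ≫ f = φ → IsIso f

/-- `Ext¹(X, Y) = 0`, expressed by the splitting of every extension of `X` by `Y`. -/
def Ext1Zero (X Y : 𝒜) : Prop :=
  ∀ (E : 𝒜) (i : Y ⟶ E) (p : E ⟶ X) (w : i ≫ p = 0),
    (ShortComplex.mk i p w).ShortExact → ∃ s : X ⟶ E, s ≫ p = 𝟙 X

/-- `ExtSucZero n X Y` says `Ext^(n+1)(X, Y) = 0`; defined by dimension shifting along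
short exact sequences `0 ⟶ Y ⟶ E ⟶ Y' ⟶ 0` with `E` injective. -/
def ExtSucZero : ℕ → 𝒜 → 𝒜 → Prop
  | 0, X, Y => Ext1Zero X Y
  | (n+1), X, Y => ∀ (E Y' : 𝒜) (i : Y ⟶ E) (p : E ⟶ Y') (w : i ≫ p = 0),
      (ShortComplex.mk i p w).ShortExact → Injective E → ExtSucZero n X Y'

/-- A special `𝒞`-precover: an epimorphism `φ : G ⟶ X` with `G ∈ 𝒞` arising in a short exact
sequence `0 ⟶ A ⟶ G ⟶ X ⟶ 0` with `Ext¹(G', A) = 0` for all `G' ∈ 𝒞`. -/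
def IsSpecialPrecover (𝒞 : 𝒜 → Prop) {G X : 𝒜} (φ : G ⟶ X) : Prop :=
  IsPrecover 𝒞 φ ∧ ∃ (A : 𝒜) (i : A ⟶ G) (w : i ≫ φ = 0),
    (ShortComplex.mk i φ w).ShortExact ∧ ∀ (G' : 𝒜), 𝒞 G' → Ext1Zero G' A

/-- The left `Ext¹`-orthogonal class `⊥𝒞` of a class of objects `𝒞`. -/
def leftOrthogonal {𝒜 : Type*} [Category 𝒜] [Abelian 𝒜] (𝒞 : 𝒜 → Prop) (X : 𝒜) : Prop :=
  ∀ Y : 𝒜, 𝒞 Y → Ext1Zero X Y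

/-- The right `Ext¹`-orthogonal class `𝒞⊥` of a class of objects `𝒞`. -/
def rightOrthogonal {𝒜 : Type*} [Category 𝒜] [Abelian 𝒜] (𝒞 : 𝒜 → Prop) (Y : 𝒜) : Prop :=
  ∀ X : 𝒜, 𝒞 X → Ext1Zero X Y

end GenericDefs

namespace CategoryTheory.ShortComplex.ShortExact

variable {𝒜 : Type*} [Category 𝒜] [Abelian 𝒜] {S : ShortComplex 𝒜}

/-- The pullback of a short exact sequence along a morphism to its third term. -/
lemma exists_isPullback (hS : S.ShortExact) {X : 𝒜} (x : X ⟶ S.X₃) :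
    ∃ (E : 𝒜) (i : S.X₁ ⟶ E) (p : E ⟶ X) (q : E ⟶ S.X₂) (w : i ≫ p = 0),
      (ShortComplex.mk i p w).ShortExact ∧ i ≫ q = S.f ∧ IsPullback q p S.g x := by
  have := hS.mono_f
  have := hS.epi_g
  have w₁ : pullback.lift S.f 0 (by simp) ≫ pullback.fst S.g x = S.f := pullback.lift_fst _ _ _
  have w₂ : pullback.lift S.f 0 (by simp) ≫ pullback.snd S.g x = 0 := pullback.lift_snd _ _ _
  refine ⟨pullback S.g x, pullback.lift S.f 0 (by simp), pullback.snd _ _, pullback.fst _ _,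
    w₂, ?_, w₁, IsPullback.of_hasPullback _ _⟩
  have hm : Mono (pullback.lift S.f 0 (by simp) : S.X₁ ⟶ pullback S.g x) :=
    mono_of_mono_fac w₁
  refine ShortExact.mk' ?_ hm inferInstance
  refine ShortComplex.exact_of_f_is_kernel _ (KernelFork.IsLimit.ofι' _ _ fun {A} k hk => ?_)
  have hk' : (k ≫ pullback.fst S.g x) ≫ S.g = 0 := by
    rw [Category.assoc, pullback.condition, reassoc_of% hk, zero_comp]
  refine ⟨hS.exact.lift _ hk', ?_⟩
  apply pullback.hom_ext
  · simp [w₁]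
  · rw [Category.assoc, w₂, comp_zero, hk]

/-- The pushout of a short exact sequence along a morphism from its first term. -/
lemma exists_isPushout (hS : S.ShortExact) {Y : 𝒜} (y : S.X₁ ⟶ Y) :
    ∃ (E : 𝒜) (i : Y ⟶ E) (p : E ⟶ S.X₃) (q : S.X₂ ⟶ E) (w : i ≫ p = 0),
      (ShortComplex.mk i p w).ShortExact ∧ q ≫ p = S.g ∧ IsPushout S.f y q i := by
  obtain ⟨E, i, p, q, w, hE, hq, hpb⟩ := hS.op.exists_isPullback y.op
  exact ⟨E.unop, p.unop, i.unop, q.unop, Quiver.Hom.op_inj w, hE.unop, Quiver.Hom.op_inj hq,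
    hpb.unop.flip⟩

lemma exists_section_of_retraction (hS : S.ShortExact) (r : S.X₂ ⟶ S.X₁)
    (hr : S.f ≫ r = 𝟙 _) : ∃ s : S.X₃ ⟶ S.X₂, s ≫ S.g = 𝟙 _ :=
  ⟨_, (Splitting.ofExactOfRetraction S hS.exact r hr hS.epi_g).s_g⟩

lemma exists_retraction_of_section (hS : S.ShortExact) (s : S.X₃ ⟶ S.X₂)
    (hs : s ≫ S.g = 𝟙 _) : ∃ r : S.X₂ ⟶ S.X₁, S.f ≫ r = 𝟙 _ :=
  ⟨_, (Splitting.ofExactOfSection S hS.exact s hs hS.mono_f).f_r⟩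

end CategoryTheory.ShortComplex.ShortExact

section OppositeApproximations

variable {𝒜 : Type*} [Category 𝒜]

lemma IsEnvelope.op {C : 𝒜 → Prop} {X G : 𝒜} {ψ : X ⟶ G} (h : IsEnvelope C ψ) :
    IsCover (fun Y : 𝒜ᵒᵖ => C Y.unop) ψ.op := by
  refine ⟨⟨h.1.1, fun G' hG' φ => ?_⟩, fun f hf => ?_⟩
  · obtain ⟨l, hl⟩ := h.1.2 G'.unop hG' φ.unop
    exact ⟨l.op, Quiver.Hom.unop_inj hl⟩
  · have := h.2 f.unop (Quiver.Hom.op_inj hf)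
    exact (isIso_unop_iff f).1 this

lemma IsCover.op {L : 𝒜 → Prop} {X G : 𝒜} {φ : G ⟶ X} (h : IsCover L φ) :
    IsEnvelope (fun Y : 𝒜ᵒᵖ => L Y.unop) φ.op := by
  refine ⟨⟨h.1.1, fun G' hG' ψ => ?_⟩, fun f hf => ?_⟩
  · obtain ⟨l, hl⟩ := h.1.2 G'.unop hG' ψ.unop
    exact ⟨l.op, Quiver.Hom.unop_inj hl⟩
  · have := h.2 f.unop (Quiver.Hom.op_inj hf)
    exact (isIso_unop_iff f).1 this

lemma IsCover.unop {C : 𝒜 → Prop} {X G : 𝒜ᵒᵖ} {φ : G ⟶ X}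
    (h : IsCover (fun Y : 𝒜ᵒᵖ => C Y.unop) φ) : IsEnvelope C φ.unop := by
  refine ⟨⟨h.1.1, fun G' hG' ψ => ?_⟩, fun f hf => ?_⟩
  · obtain ⟨l, hl⟩ := h.1.2 (Opposite.op G') hG' ψ.op
    exact ⟨l.unop, Quiver.Hom.op_inj hl⟩
  · have := h.2 f.op (Quiver.Hom.unop_inj hf)
    exact (isIso_op_iff f).1 this

end OppositeApproximations

section GenericLemmas

variable {𝒜 : Type*} [Category 𝒜] [Abelian 𝒜]

lemma Ext1Zero.op {X Y : 𝒜} (h : Ext1Zero X Y) :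
    Ext1Zero (Opposite.op Y) (Opposite.op X) := by
  intro E i p w hE
  obtain ⟨s, hs⟩ := h E.unop p.unop i.unop (Quiver.Hom.op_inj w) hE.unop
  obtain ⟨r, hr⟩ := hE.unop.exists_retraction_of_section s hs
  exact ⟨r.op, Quiver.Hom.unop_inj hr⟩

lemma Ext1Zero.unop {X Y : 𝒜ᵒᵖ} (h : Ext1Zero X Y) :
    Ext1Zero Y.unop X.unop := by
  intro E i p w hE
  obtain ⟨s, hs⟩ := h (Opposite.op E) p.op i.op (Quiver.Hom.unop_inj w) hE.op
  obtain ⟨r, hr⟩ := hE.op.exists_retraction_of_section s hs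
  exact ⟨r.unop, Quiver.Hom.op_inj hr⟩

lemma Ext1Zero.exists_lift {X : 𝒜} {S : ShortComplex 𝒜} (h : Ext1Zero X S.X₁)
    (hS : S.ShortExact) (x : X ⟶ S.X₃) : ∃ l : X ⟶ S.X₂, l ≫ S.g = x := by
  obtain ⟨E, i, p, q, w, hE, -, hpb⟩ := hS.exists_isPullback x
  obtain ⟨s, hs⟩ := h E i p w hE
  exact ⟨s ≫ q, by rw [Category.assoc, hpb.w, reassoc_of% hs]⟩

lemma Ext1Zero.exists_desc {Y : 𝒜} {S : ShortComplex 𝒜} (h : Ext1Zero S.X₃ Y)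
    (hS : S.ShortExact) (y : S.X₁ ⟶ Y) : ∃ l : S.X₂ ⟶ Y, S.f ≫ l = y := by
  obtain ⟨l, hl⟩ := Ext1Zero.exists_lift (S := S.op) h.op hS.op y.op
  exact ⟨l.unop, Quiver.Hom.op_inj hl⟩

lemma ext1Zero_of_injective (X : 𝒜) {I : 𝒜} [Injective I] : Ext1Zero X I := by
  intro E i p w hE
  have := hE.mono_f
  exact hE.exists_section_of_retraction (Injective.factorThru (𝟙 I) i)
    (Injective.comp_factorThru _ _)

lemma ext1Zero_of_projective {P : 𝒜} [Projective P] (Y : 𝒜) : Ext1Zero P Y := by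
  intro E i p w hE
  have := hE.epi_g
  exact ⟨Projective.factorThru (𝟙 P) p, Projective.factorThru_comp _ _⟩

/-- `Ext¹(X, Y)` vanishes as soon as morphisms from `X` lift along the last map of some short
exact sequence `0 ⟶ Y ⟶ I ⟶ Z ⟶ 0` with `I` injective. -/
lemma ext1Zero_of_forall_exists_lift {X : 𝒜} {S : ShortComplex 𝒜} (hS : S.ShortExact)
    [Injective S.X₂] (h : ∀ x : X ⟶ S.X₃, ∃ l : X ⟶ S.X₂, l ≫ S.g = x) :
    Ext1Zero X S.X₁ := by
  intro E i p w hE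
  have := hE.mono_f
  have := hE.epi_g
  have := hS.mono_f
  let e : E ⟶ S.X₂ := Injective.factorThru S.f i
  have he : i ≫ e = S.f := Injective.comp_factorThru _ _
  have he' : i ≫ e ≫ S.g = 0 := by rw [reassoc_of% he, S.zero]
  obtain ⟨l, hl⟩ := h (hE.exact.desc (e ≫ S.g) he')
  have hpl : p ≫ l ≫ S.g = e ≫ S.g := by
    rw [hl]; exact hE.exact.g_desc _ _
  refine hE.exists_section_of_retraction (hS.exact.lift (e - p ≫ l) ?_) ?_
  · simp [hpl]
  · rw [← cancel_mono S.f]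
    simp [he, reassoc_of% w]

lemma ext1Zero_of_forall_exists_desc {Y : 𝒜} {S : ShortComplex 𝒜} (hS : S.ShortExact)
    [Projective S.X₂] (h : ∀ y : S.X₁ ⟶ Y, ∃ l : S.X₂ ⟶ Y, S.f ≫ l = y) :
    Ext1Zero S.X₃ Y := by
  have : Injective S.op.X₂ := inferInstanceAs (Injective (Opposite.op S.X₂))
  refine (ext1Zero_of_forall_exists_lift (X := Opposite.op Y) hS.op fun y => ?_).unop
  obtain ⟨l, hl⟩ := h y.unop
  exact ⟨l.op, Quiver.Hom.unop_inj hl⟩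

/-- A short exact sequence embedding an object in an injective one. -/
lemma exists_shortExact_injective [EnoughInjectives 𝒜] (Y : 𝒜) :
    ∃ (I Z : 𝒜) (i : Y ⟶ I) (p : I ⟶ Z) (w : i ≫ p = 0),
      (ShortComplex.mk i p w).ShortExact ∧ Injective I :=
  ⟨_, _, Injective.ι Y, cokernel.π _, cokernel.condition _,
    .mk' (ShortComplex.exact_cokernel _) inferInstance inferInstance, inferInstance⟩

/-- A short exact sequence presenting an object as a quotient of a projective one. -/
lemma exists_shortExact_projective [EnoughProjectives 𝒜] (X : 𝒜) :
    ∃ (K P : 𝒜) (i : K ⟶ P) (p : P ⟶ X) (w : i ≫ p = 0),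
      (ShortComplex.mk i p w).ShortExact ∧ Projective P :=
  ⟨_, _, kernel.ι (Projective.π X), Projective.π X, kernel.condition _,
    .mk' (ShortComplex.exact_kernel _) inferInstance inferInstance, inferInstance⟩

lemma Ext1Zero.of_shortExact [EnoughInjectives 𝒜] {S : ShortComplex 𝒜} (hS : S.ShortExact)
    {Y : 𝒜} (h₁ : Ext1Zero S.X₁ Y) (h₃ : Ext1Zero S.X₃ Y) : Ext1Zero S.X₂ Y := by
  obtain ⟨I, Z, i, p, w, hI, _⟩ := exists_shortExact_injective Y
  have := hS.mono_f
  refine ext1Zero_of_forall_exists_lift hI fun x => ?_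
  obtain ⟨a, ha⟩ := h₁.exists_lift hI (S.f ≫ x)
  let b : S.X₂ ⟶ I := Injective.factorThru a S.f
  have hb : S.f ≫ b = a := Injective.comp_factorThru _ _
  have hx : S.f ≫ (x - b ≫ p) = 0 := by
    rw [Preadditive.comp_sub, reassoc_of% hb, ← ha, sub_self]
  have := hS.epi_g
  obtain ⟨c, hc⟩ := h₃.exists_lift hI (hS.exact.desc _ hx)
  refine ⟨b + S.g ≫ c, ?_⟩
  have : S.g ≫ c ≫ p = x - b ≫ p := by
    rw [hc]; exact hS.exact.g_desc _ _
  simp [this]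

/-- **Wakamatsu's lemma** for covers: the kernel of an epimorphic cover by a class closed under
extensions is right orthogonal to that class. -/
lemma IsCover.rightOrthogonal_of_shortExact {L : 𝒜 → Prop}
    (hL : ∀ S : ShortComplex 𝒜, S.ShortExact → L S.X₁ → L S.X₃ → L S.X₂)
    {S : ShortComplex 𝒜} (hS : S.ShortExact) (h : IsCover L S.g) :
    rightOrthogonal L S.X₁ := by
  intro G hG E i p w hE
  obtain ⟨Q, i', p', q, w', hQ, -, hpo⟩ := hE.exists_isPushout S.f
  obtain ⟨k, hk⟩ := h.1.2 Q (hL _ hQ h.1.1 hG) (hpo.desc 0 S.g (by simp))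
  have hik : (i' ≫ k) ≫ S.g = S.g := by rw [Category.assoc, hk, hpo.inr_desc]
  have := h.2 _ hik
  have := hS.mono_f
  have hinv : inv (i' ≫ k) ≫ S.g = S.g := by rw [IsIso.inv_comp_eq, hik]
  have ht : (q ≫ k ≫ inv (i' ≫ k)) ≫ S.g = 0 := by
    rw [Category.assoc, Category.assoc, hinv, hk, hpo.inl_desc]
  refine hE.exists_section_of_retraction (hS.exact.lift _ ht) ?_
  rw [← cancel_mono S.f, Category.assoc, hS.exact.lift_f, Category.id_comp]
  have := hpo.w
  dsimp at this ⊢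
  rw [reassoc_of% this, ← Category.assoc i', IsIso.hom_inv_id, Category.comp_id]

/-- The two orthogonality conditions of a cotorsion pair, packaged as one predicate. -/
structure IsCotorsionPair (L C : 𝒜 → Prop) : Prop where
  left_iff : ∀ X, L X ↔ leftOrthogonal C X
  right_iff : ∀ Y, C Y ↔ rightOrthogonal L Y

namespace IsCotorsionPair

variable {L C : 𝒜 → Prop}

lemma ext1Zero (h : IsCotorsionPair L C) {X Y : 𝒜} (hX : L X) (hY : C Y) : Ext1Zero X Y :=
  (h.left_iff X).1 hX Y hY

lemma op (h : IsCotorsionPair L C) :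
    IsCotorsionPair (fun X : 𝒜ᵒᵖ => C X.unop) (fun X : 𝒜ᵒᵖ => L X.unop) where
  left_iff X := (h.right_iff X.unop).trans
    ⟨fun hX Y hY => (hX Y.unop hY).op, fun hX Y hY => (hX (Opposite.op Y) hY).unop⟩
  right_iff X := (h.left_iff X.unop).trans
    ⟨fun hX Y hY => (hX Y.unop hY).op, fun hX Y hY => (hX (Opposite.op Y) hY).unop⟩

lemma left_of_projective (h : IsCotorsionPair L C) (P : 𝒜) [Projective P] : L P :=
  (h.left_iff P).2 fun Y _ => ext1Zero_of_projective Y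

lemma right_of_injective (h : IsCotorsionPair L C) (I : 𝒜) [Injective I] : C I :=
  (h.right_iff I).2 fun X _ => ext1Zero_of_injective X

lemma left_of_shortExact [EnoughInjectives 𝒜] (h : IsCotorsionPair L C) (S : ShortComplex 𝒜)
    (hS : S.ShortExact) (h₁ : L S.X₁) (h₃ : L S.X₃) : L S.X₂ :=
  (h.left_iff _).2 fun _ hY => .of_shortExact hS (h.ext1Zero h₁ hY) (h.ext1Zero h₃ hY)

lemma epi_of_isPrecover [EnoughProjectives 𝒜] (h : IsCotorsionPair L C) {G X : 𝒜} {φ : G ⟶ X}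
    (hφ : IsPrecover L φ) : Epi φ := by
  obtain ⟨k, hk⟩ := hφ.2 _ (h.left_of_projective (Projective.over X)) (Projective.π X)
  exact epi_of_epi_fac hk

lemma right_kernel_of_isCover [EnoughInjectives 𝒜] (h : IsCotorsionPair L C)
    {S : ShortComplex 𝒜} (hS : S.ShortExact) (hg : IsCover L S.g) : C S.X₁ :=
  (h.right_iff _).2 (hg.rightOrthogonal_of_shortExact h.left_of_shortExact hS)

lemma left_cokernel_of_isEnvelope [EnoughProjectives 𝒜] (h : IsCotorsionPair L C)
    {S : ShortComplex 𝒜} (hS : S.ShortExact) (hf : IsEnvelope C S.f) : L S.X₃ :=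
  h.op.right_kernel_of_isCover hS.op hf.op

lemma mono_of_isEnvelope [EnoughInjectives 𝒜] (h : IsCotorsionPair L C) {X G : 𝒜} {ψ : X ⟶ G}
    (hψ : IsEnvelope C ψ) : Mono ψ := by
  obtain ⟨k, hk⟩ := hψ.1.2 _ (h.right_of_injective (Injective.under X)) (Injective.ι X)
  exact mono_of_mono_fac hk

/-- Covers of `C`-objects restrict, along `C`-envelopes, to covers of arbitrary objects. -/
theorem exists_isCover [EnoughInjectives 𝒜] [EnoughProjectives 𝒜] (h : IsCotorsionPair L C)
    (hker : ∀ S : ShortComplex 𝒜, S.ShortExact → L S.X₂ → L S.X₃ → L S.X₁)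
    (henv : ∀ X : 𝒜, ∃ (Y : 𝒜) (ψ : X ⟶ Y), IsEnvelope C ψ)
    (hcov : ∀ Y : 𝒜, C Y → ∃ (P : 𝒜) (φ : P ⟶ Y), IsCover L φ) (X : 𝒜) :
    ∃ (P : 𝒜) (φ : P ⟶ X), IsCover L φ := by
  obtain ⟨Y, ψ, hψ⟩ := henv X
  have := h.mono_of_isEnvelope hψ
  obtain ⟨P, φ, hφ⟩ := hcov Y hψ.1.1
  have := h.epi_of_isPrecover hφ.1
  let S : ShortComplex 𝒜 := .mk ψ (cokernel.π ψ) (cokernel.condition ψ)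
  have hS : S.ShortExact := .mk' (ShortComplex.exact_cokernel _) inferInstance inferInstance
  let T : ShortComplex 𝒜 := .mk (kernel.ι φ) φ (kernel.condition φ)
  have hT : T.ShortExact := .mk' (ShortComplex.exact_kernel _) inferInstance inferInstance
  have hCK : C T.X₁ := h.right_kernel_of_isCover hT hφ
  have hLZ : L S.X₃ := h.left_cokernel_of_isEnvelope hS hψ
  obtain ⟨Q, k, φ', i, wk, hQ, -, hpb⟩ := hT.exists_isPullback ψ
  have : Mono i := ⟨fun a b hab => hpb.hom_ext hab <| by
    rw [← cancel_mono ψ, Category.assoc, Category.assoc, ← hpb.w, reassoc_of% hab]⟩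
  have hi : i ≫ φ ≫ S.g = 0 := by rw [← Category.assoc, hpb.w, Category.assoc, S.zero, comp_zero]
  have hU : (ShortComplex.mk i (φ ≫ S.g) hi).ShortExact := by
    have := hS.epi_g
    refine .mk' ?_ inferInstance (epi_comp φ S.g)
    refine ShortComplex.exact_of_f_is_kernel _ (KernelFork.IsLimit.ofι' _ _ fun {A} a ha => ?_)
    exact ⟨hpb.lift a (hS.exact.lift (a ≫ φ) (by simpa using ha)) (hS.exact.lift_f _ _).symm,
      hpb.lift_fst _ _ _⟩
  refine ⟨Q, φ', ⟨hker _ hU hφ.1.1 hLZ, fun G hG x => ?_⟩, fun f hf => ?_⟩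
  · have hGK : Ext1Zero G T.X₁ := h.ext1Zero hG hCK
    exact Ext1Zero.exists_lift (S := .mk k φ' wk) hGK hQ x
  · have hd : (i - f ≫ i) ≫ φ = 0 := by
      rw [Preadditive.sub_comp, Category.assoc, hpb.w, reassoc_of% hf, sub_self]
    have := hT.mono_f
    have hZK : Ext1Zero S.X₃ T.X₁ := h.ext1Zero hLZ hCK
    obtain ⟨D, hD⟩ : ∃ D : P ⟶ T.X₁, i ≫ D = hT.exact.lift (i - f ≫ i) hd :=
      Ext1Zero.exists_desc (S := .mk i (φ ≫ S.g) hi) hZK hU _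
    have hiD : i ≫ D ≫ T.f = i - f ≫ i := by
      rw [reassoc_of% hD, hT.exact.lift_f]
    let g : P ⟶ P := 𝟙 P - D ≫ T.f
    have hg : g ≫ φ = φ := by
      simp [g, T]
    have hig : i ≫ g = f ≫ i := by
      rw [Preadditive.comp_sub, hiD]
      exact (congrArg (· - _) (Category.comp_id i)).trans (sub_sub_cancel _ _)
    have := hφ.2 g hg
    have hinv : inv g ≫ φ = φ := by rw [IsIso.inv_comp_eq, hg]
    have hw : (i ≫ inv g) ≫ φ = φ' ≫ ψ := by rw [Category.assoc, hinv, hpb.w]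
    refine ⟨hpb.lift _ _ hw, ?_, ?_⟩ <;> rw [← cancel_mono i]
    · rw [Category.assoc, hpb.lift_fst, ← Category.assoc, ← hig]
      simp
    · rw [Category.assoc, ← hig, ← Category.assoc, hpb.lift_fst]
      simp

theorem exists_isEnvelope [EnoughInjectives 𝒜] [EnoughProjectives 𝒜] (h : IsCotorsionPair L C)
    (hcoker : ∀ S : ShortComplex 𝒜, S.ShortExact → C S.X₁ → C S.X₂ → C S.X₃)
    (hcov : ∀ X : 𝒜, ∃ (P : 𝒜) (φ : P ⟶ X), IsCover L φ)
    (henv : ∀ X : 𝒜, L X → ∃ (Y : 𝒜) (ψ : X ⟶ Y), IsEnvelope C ψ) (X : 𝒜) :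
    ∃ (Y : 𝒜) (ψ : X ⟶ Y), IsEnvelope C ψ := by
  obtain ⟨P, φ, hφ⟩ := h.op.exists_isCover (fun S hS h₂ h₃ => hcoker _ hS.unop h₃ h₂)
    (fun X => let ⟨P, φ, hφ⟩ := hcov X.unop; ⟨.op P, φ.op, hφ.op⟩)
    (fun X hX => let ⟨P, φ, hφ⟩ := henv X.unop hX; ⟨.op P, φ.op, hφ.op⟩) (.op X)
  exact ⟨P.unop, φ.unop, hφ.unop⟩

/-- If `Ext²` vanishes on a cotorsion pair, the left class is closed under kernels of
epimorphisms. -/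
lemma left_kernel [EnoughInjectives 𝒜] (h : IsCotorsionPair L C)
    (hher : ∀ X, L X → ∀ Y, C Y → ExtSucZero 1 X Y)
    (S : ShortComplex 𝒜) (hS : S.ShortExact) (h₂ : L S.X₂) (h₃ : L S.X₃) : L S.X₁ := by
  refine (h.left_iff _).2 fun Y hY => ?_
  obtain ⟨I, Z, i, p, w, hI, hinj⟩ := exists_shortExact_injective Y
  refine ext1Zero_of_forall_exists_lift hI fun x => ?_
  obtain ⟨z, hz⟩ := Ext1Zero.exists_desc (hher _ h₃ Y hY I Z i p w hI hinj) hS x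
  obtain ⟨l, hl⟩ := (h.ext1Zero h₂ hY).exists_lift hI z
  exact ⟨S.f ≫ l, by rw [Category.assoc, hl, hz]⟩

/-- If the left class is closed under kernels of epimorphisms, the right class is closed under
cokernels of monomorphisms. -/
lemma right_cokernel [EnoughProjectives 𝒜] (h : IsCotorsionPair L C)
    (hker : ∀ S : ShortComplex 𝒜, S.ShortExact → L S.X₂ → L S.X₃ → L S.X₁)
    (S : ShortComplex 𝒜) (hS : S.ShortExact) (h₁ : C S.X₁) (h₂ : C S.X₂) : C S.X₃ := by
  refine (h.right_iff _).2 fun X hX => ?_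
  obtain ⟨K, P, i, p, w, hP, _⟩ := exists_shortExact_projective X
  refine ext1Zero_of_forall_exists_desc hP fun y => ?_
  obtain ⟨l, hl⟩ :=
    (h.ext1Zero (hker _ hP (h.left_of_projective P) hX) h₁).exists_lift hS y
  obtain ⟨m, hm⟩ := (h.ext1Zero hX h₂).exists_desc hP l
  exact ⟨m ≫ S.g, by rw [← Category.assoc, hm, hl]⟩

end IsCotorsionPair

end GenericLemmas

namespace HomologicalComplex

variable {C : Type*} [Category C] [Abelian C] {ι : Type*} (c : ComplexShape ι) [c.HasNoLoop]

lemma projective_evalCompCoyonedaCorepresentative (P : C) [Projective P] (j : ι) :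
    Projective (evalCompCoyonedaCorepresentative c P j) where
  factors {E X} f e _ := by
    have H := evalCompCoyonedaCorepresentable c P j
    let x : P ⟶ X.X j := H.homEquiv f
    let y : P ⟶ E.X j := Projective.factorThru x (e.f j)
    have hy : y ≫ e.f j = x := Projective.factorThru_comp _ _
    refine ⟨H.homEquiv.symm y, H.homEquiv.injective ?_⟩
    exact ((H.homEquiv_comp e _).trans
      (congrArg _ (Equiv.apply_symm_apply H.homEquiv y))).trans hy

instance enoughProjectives [EnoughProjectives C] [HasCoproductsOfShape ι C] :
    EnoughProjectives (HomologicalComplex C c) where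
  presentation K := by
    let D (j : ι) := evalCompCoyonedaCorepresentative c (Projective.over (K.X j)) j
    let H (j : ι) := evalCompCoyonedaCorepresentable c (Projective.over (K.X j)) j
    have (j : ι) : Projective (D j) := projective_evalCompCoyonedaCorepresentative c _ j
    let φ (j : ι) : D j ⟶ K := (H j).homEquiv.symm (Projective.π (K.X j))
    let u (j : ι) : Projective.over (K.X j) ⟶ (D j).X j := (H j).homEquiv (𝟙 (D j))
    have hφ (j : ι) : u j ≫ (φ j).f j = Projective.π (K.X j) :=
      (((H j).homEquiv_comp (φ j) (𝟙 _)).symm.trans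
        (congrArg _ (Category.id_comp _))).trans (Equiv.apply_symm_apply _ _)
    have : HasCoproduct D := inferInstance
    have hD : Projective (∐ D) :=
      ⟨fun f e _ => ⟨Sigma.desc fun j => Projective.factorThru (Sigma.ι D j ≫ f) e,
        Sigma.hom_ext _ _ fun j => by simp⟩⟩
    refine ⟨{ p := ∐ D, projective := hD, f := Sigma.desc φ, epi := ?_ }⟩
    refine @epi_of_epi_f _ _ _ _ _ _ _ (Sigma.desc φ) fun j => ?_
    refine epi_of_epi_fac (f := u j ≫ (Sigma.ι D j).f j)
      (h := Projective.π (K.X j)) ?_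
    rw [Category.assoc, ← comp_f, Sigma.ι_desc, hφ]

end HomologicalComplex

/-- Let `(𝕃, ℭ)` be a hereditary cotorsion pair in `Ch(R)`.  The following
are equivalent: (1) the pair is perfect (every complex has an `𝕃`-cover and a `ℭ`-envelope);
(2) every complex has a `ℭ`-envelope and every object of `ℭ` has an `𝕃`-cover; (3) every
complex has an `𝕃`-cover and every object of `𝕃` has a `ℭ`-envelope. -/
theorem hereditary_cotorsion_pair_perfect_tfae
    (R : Type u) [Ring R]
    (𝕃 ℭ : ChainComplex (ModuleCat.{u} R) ℤ → Prop)
    (hpair₁ : ∀ X, 𝕃 X ↔ leftOrthogonal ℭ X)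
    (hpair₂ : ∀ Y, ℭ Y ↔ rightOrthogonal 𝕃 Y)
    (hher : ∀ L, 𝕃 L → ∀ Y, ℭ Y → ∀ n : ℕ, ExtSucZero n L Y) :
    (((∀ X : ChainComplex (ModuleCat.{u} R) ℤ, ∃ (L : ChainComplex (ModuleCat.{u} R) ℤ)
        (φ : L ⟶ X), IsCover 𝕃 φ) ∧
      (∀ X : ChainComplex (ModuleCat.{u} R) ℤ, ∃ (C : ChainComplex (ModuleCat.{u} R) ℤ)
        (ψ : X ⟶ C), IsEnvelope ℭ ψ)) ↔
     ((∀ X : ChainComplex (ModuleCat.{u} R) ℤ, ∃ (C : ChainComplex (ModuleCat.{u} R) ℤ)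
        (ψ : X ⟶ C), IsEnvelope ℭ ψ) ∧
      (∀ C₀ : ChainComplex (ModuleCat.{u} R) ℤ, ℭ C₀ →
        ∃ (L : ChainComplex (ModuleCat.{u} R) ℤ) (φ : L ⟶ C₀), IsCover 𝕃 φ))) ∧
    (((∀ X : ChainComplex (ModuleCat.{u} R) ℤ, ∃ (C : ChainComplex (ModuleCat.{u} R) ℤ)
        (ψ : X ⟶ C), IsEnvelope ℭ ψ) ∧
      (∀ C₀ : ChainComplex (ModuleCat.{u} R) ℤ, ℭ C₀ →
        ∃ (L : ChainComplex (ModuleCat.{u} R) ℤ) (φ : L ⟶ C₀), IsCover 𝕃 φ)) ↔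
     ((∀ X : ChainComplex (ModuleCat.{u} R) ℤ, ∃ (L : ChainComplex (ModuleCat.{u} R) ℤ)
        (φ : L ⟶ X), IsCover 𝕃 φ) ∧
      (∀ L₀ : ChainComplex (ModuleCat.{u} R) ℤ, 𝕃 L₀ →
        ∃ (C : ChainComplex (ModuleCat.{u} R) ℤ) (ψ : L₀ ⟶ C), IsEnvelope ℭ ψ))) := by
  have hp : IsCotorsionPair 𝕃 ℭ := ⟨hpair₁, hpair₂⟩
  have hker := hp.left_kernel fun X hX Y hY => hher X hX Y hY 1
  refine ⟨⟨fun h => ⟨h.2, fun Y _ => h.1 Y⟩, fun h => ⟨hp.exists_isCover hker h.1 h.2, h.1⟩⟩,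
    fun h => ⟨hp.exists_isCover hker h.1 h.2, fun X _ => h.1 X⟩,
    fun h => ⟨hp.exists_isEnvelope (hp.right_cokernel hker) h.1 h.2, fun Y _ => h.1 Y⟩⟩
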